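/- Every instance (G,b,w) of Multiple Partners Assignment, i.e. with G a finite simple bipartite graph, positive vertex capacities b and positive edge weights w, has a stable solution. Moreover, if (M,p) is a stable solution for (G,b,w), then M is a maximum weight b-matching of G and the total pay-off vector p^t is a core allocation of the b-assignment game defined on (G,b,w). -/

import Mathlib

open scoped Classical
open Finset

namespace MatchingGames

variable {V : Type*}

/-- `M` is a matching of the graph `G`: a set of edges of `G` that are pairwise
vertex-disjoint. -/
def IsMatching (G : SimpleGraph V) (M : Finset (Sym2 V)) : Prop :=
  (∀ e ∈ M, e ∈ G.edgeSet) ∧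
    ∀ e ∈ M, ∀ f ∈ M, e ≠ f → ∀ v : V, v ∈ e → v ∉ f

/-- every endpoint of every edge of `M` belongs to the coalition `S`, i.e. `M` is a
set of edges of the induced subgraph `G[S]`. -/
def EdgesIn (S : Finset V) (M : Finset (Sym2 V)) : Prop :=
  ∀ e ∈ M, ∀ v : V, v ∈ e → v ∈ S

/-- the weight `w(M)` of a set of edges `M`. -/
noncomputable def mWeight (w : Sym2 V → ℝ) (M : Finset (Sym2 V)) : ℝ :=
  ∑ e ∈ M, w e

/-- the value `v(S)` of a coalition `S` in the matching game on `(G,w)`: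
the maximum weight of a matching of the induced subgraph `G[S]`. -/
noncomputable def matchVal (G : SimpleGraph V) (w : Sym2 V → ℝ) (S : Finset V) : ℝ :=
  sSup {t | ∃ M : Finset (Sym2 V), IsMatching G M ∧ EdgesIn S M ∧ t = mWeight w M}

/-- `x` is a core allocation of the cooperative game with value function `v`:
`x(N) = v(N)` and `x(S) ≥ v(S)` for every coalition `S`. -/
def InCore [Fintype V] (v : Finset V → ℝ) (x : V → ℝ) : Prop :=
  (∑ i, x i) = v Finset.univ ∧ ∀ S : Finset V, v S ≤ ∑ i ∈ S, x i

/-- `M` is a `b`-matching of `G`: a set of edges of `G` such that every vertex `i` is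
incident to at most `b i` edges of `M`. -/
def IsBMatching [DecidableEq V] (G : SimpleGraph V) (b : V → ℕ)
    (M : Finset (Sym2 V)) : Prop :=
  (∀ e ∈ M, e ∈ G.edgeSet) ∧ ∀ i : V, (M.filter (fun e => i ∈ e)).card ≤ b i

/-- the value `v(S)` of a coalition `S` in the `b`-matching game on `(G,b,w)`:
the maximum weight of a `b`-matching of the induced subgraph `G[S]`. -/
noncomputable def bVal [DecidableEq V] (G : SimpleGraph V) (b : V → ℕ)
    (w : Sym2 V → ℝ) (S : Finset V) : ℝ :=
  sSup {t | ∃ M : Finset (Sym2 V), IsBMatching G b M ∧ EdgesIn S M ∧ t = mWeight w M}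

/-- `(M,p)` is a solution for the instance `(G,b,w)`: `M` is a `b`-matching of `G`,
matched pairs split the weight of their edge into two nonnegative pay-offs, and all
other pay-offs are zero. -/
def IsBSolution [DecidableEq V] (G : SimpleGraph V) (b : V → ℕ) (w : Sym2 V → ℝ)
    (M : Finset (Sym2 V)) (p : V → V → ℝ) : Prop :=
  IsBMatching G b M ∧
    (∀ i j : V, s(i, j) ∈ M → 0 ≤ p i j ∧ 0 ≤ p j i ∧ p i j + p j i = w s(i, j)) ∧
    ∀ i j : V, s(i, j) ∉ M → p i j = 0

/-- the total pay-off vector `p^t`. -/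
noncomputable def totalPayoff [Fintype V] (p : V → V → ℝ) (i : V) : ℝ := ∑ j, p i j

/-- the utility `u_p(i)`: the `b i`-th largest pay-off `p i j` over the edges `ij` of
`G` (taken as `0` if `i` has fewer than `b i` incident edges; note that in Lean
`sSup ∅ = 0` for real numbers). -/
noncomputable def utility [Fintype V] (G : SimpleGraph V) (b : V → ℕ)
    (p : V → V → ℝ) (i : V) : ℝ :=
  sSup {t : ℝ | b i ≤ (Finset.univ.filter (fun j : V => G.Adj i j ∧ t ≤ p i j)).card}

/-- a solution `(M,p)` for `(G,b,w)` is stable if no pair `{i,j}` with `ij ∈ E \ M`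
satisfies `u_p(i) + u_p(j) < w(ij)`. -/
def IsBStable [Fintype V] [DecidableEq V] (G : SimpleGraph V) (b : V → ℕ)
    (w : Sym2 V → ℝ) (M : Finset (Sym2 V)) (p : V → V → ℝ) : Prop :=
  IsBSolution G b w M p ∧
    ∀ i j : V, G.Adj i j → s(i, j) ∉ M →
      w s(i, j) ≤ utility G b p i + utility G b p j

/-- Potentials exist for a weighted digraph without negative simple cycles. -/
theorem exists_potential {N : Type*} [Fintype N] (R : N → N → Prop) (c : N → N → ℝ)
    (hcyc : ∀ (n : ℕ) (g : Fin (n + 1) → N), Function.Injective g →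
      (∀ i, R (g i) (g (i + 1))) → 0 ≤ ∑ i, c (g i) (g (i + 1))) :
    ∃ q : N → ℝ, ∀ u v, R u v → q v ≤ q u + c u v := by
  let P : N → Set ℝ := fun v => {t | ∃ (k : ℕ) (f : ℕ → N), Set.InjOn f (Set.Iic k) ∧
    f k = v ∧ (∀ i < k, R (f i) (f (i + 1))) ∧ t = ∑ i ∈ range k, c (f i) (f (i + 1))}
  have hne : ∀ v, (P v).Nonempty := by
    intro v
    refine ⟨0, 0, fun _ => v, ?_, rfl, by simp, by simp⟩
    intro a ha b hb _
    simp only [Set.mem_Iic, Nat.le_zero] at ha hb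
    rw [ha, hb]
  obtain ⟨C, hC0, hC⟩ : ∃ C : ℝ, 0 ≤ C ∧ ∀ x y, -C ≤ c x y := by
    refine ⟨∑ x, ∑ y, |c x y|, by positivity, fun x y => ?_⟩
    have h1 : |c x y| ≤ ∑ y, |c x y| :=
      Finset.single_le_sum (f := fun y => |c x y|) (fun _ _ => abs_nonneg _) (mem_univ y)
    have h2 : ∑ y, |c x y| ≤ ∑ x, ∑ y, |c x y| :=
      Finset.single_le_sum (f := fun x => ∑ y, |c x y|)
        (fun _ _ => Finset.sum_nonneg fun _ _ => abs_nonneg _) (mem_univ x)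
    have h3 := neg_abs_le (c x y)
    linarith
  have hbdd : ∀ v, BddBelow (P v) := by
    intro v
    refine ⟨-(Fintype.card N * C), ?_⟩
    rintro t ⟨k, f, hf, -, -, rfl⟩
    have hk : k ≤ Fintype.card N := by
      have h1 : ((range (k + 1)).image f).card = k + 1 := by
        rw [Finset.card_image_of_injOn, card_range]
        intro a ha b hb h
        simp only [coe_range, Set.mem_Iio] at ha hb
        exact hf (Set.mem_Iic.2 (by omega)) (Set.mem_Iic.2 (by omega)) h
      have h2 := Finset.card_le_univ ((range (k + 1)).image f)
      omega
    have h1 : ∑ i ∈ range k, (-C) ≤ ∑ i ∈ range k, c (f i) (f (i + 1)) :=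
      Finset.sum_le_sum fun i _ => hC _ _
    simp only [sum_const, card_range, nsmul_eq_mul] at h1
    have h2 : (k : ℝ) * C ≤ Fintype.card N * C := by gcongr
    linarith
  refine ⟨fun v => sInf (P v), fun u v huv => ?_⟩
  show sInf (P v) ≤ sInf (P u) + c u v
  rw [← sub_le_iff_le_add]
  refine le_csInf (hne u) ?_
  rintro t ⟨k, f, hf, rfl, hR, rfl⟩
  rw [sub_le_iff_le_add]
  by_cases hv : ∃ m, m ≤ k ∧ f m = v
  · obtain ⟨m, hm, rfl⟩ := hv
    obtain ⟨n, rfl⟩ := Nat.exists_eq_add_of_le hm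
    have hstep : ∀ i : Fin (n + 1), i ≠ Fin.last n → ((i + 1 : Fin (n + 1)) : ℕ) = i + 1 := by
      intro i hi
      rw [Fin.val_add_one, if_neg hi]
    have h0 := hcyc n (fun i => f (m + i)) (by
        intro a b hab
        have := hf (Set.mem_Iic.2 (by omega)) (Set.mem_Iic.2 (by omega)) hab
        ext; omega) (by
        intro i
        by_cases hi : i = Fin.last n
        · subst hi; simpa using huv
        · have : (i : ℕ) ≠ n := fun h => hi (Fin.ext h)
          simp only [hstep i hi]
          exact hR (m + i) (by omega))
    rw [Fin.sum_univ_castSucc] at h0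
    have h1 : ∑ i : Fin n, c (f (m + (i.castSucc : Fin (n + 1))))
        (f (m + (i.castSucc + 1 : Fin (n + 1)))) =
        ∑ i ∈ range n, c (f (m + i)) (f (m + i + 1)) := by
      rw [Finset.sum_range]
      refine Finset.sum_congr rfl fun i _ => ?_
      rw [hstep _ (Fin.castSucc_lt_last i).ne]
      rfl
    rw [h1] at h0
    simp only [Fin.val_last, Fin.last_add_one, Fin.val_zero, add_zero] at h0
    rw [Finset.sum_range_add]
    have h2 : sInf (P (f m)) ≤ ∑ i ∈ range m, c (f i) (f (i + 1)) := by
      refine csInf_le (hbdd _) ⟨m, f, hf.mono (Set.Iic_subset_Iic.2 hm), rfl,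
        fun i hi => hR i (by omega), rfl⟩
    linarith
  · push Not at hv
    refine csInf_le (hbdd _) ⟨k + 1, Function.update f (k + 1) v, ?_, by simp, ?_, ?_⟩
    · intro a ha b hb hab
      simp only [Set.mem_Iic] at ha hb
      by_cases h1 : a = k + 1 <;> by_cases h2 : b = k + 1
      · omega
      · subst h1
        rw [Function.update_self, Function.update_of_ne h2] at hab
        exact absurd hab.symm (hv b (by omega))
      · subst h2
        rw [Function.update_self, Function.update_of_ne h1] at hab
        exact absurd hab (hv a (by omega))
      · rw [Function.update_of_ne h1, Function.update_of_ne h2] at hab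
        exact hf (Set.mem_Iic.2 (by omega)) (Set.mem_Iic.2 (by omega)) hab
    · intro i hi
      rw [Function.update_of_ne (by omega : i ≠ k + 1)]
      by_cases h : i = k
      · subst h; simpa using huv
      · rw [Function.update_of_ne (by omega)]
        exact hR i (by omega)
    · rw [Finset.sum_range_succ, Function.update_of_ne (by omega : k ≠ k + 1),
        Function.update_self]
      congr 1
      refine Finset.sum_congr rfl fun i hi => ?_
      rw [Finset.mem_range] at hi
      rw [Function.update_of_ne (by omega), Function.update_of_ne (by omega)]

/-- the set of partners of `i` in `M`. -/
def nb [Fintype V] [DecidableEq V] (M : Finset (Sym2 V)) (i : V) : Finset V :=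
  univ.filter fun j => s(i, j) ∈ M

theorem mem_nb [Fintype V] [DecidableEq V] {M : Finset (Sym2 V)} {i j : V} :
    j ∈ nb M i ↔ s(i, j) ∈ M := by simp [nb]

theorem card_nb [Fintype V] [DecidableEq V] (M : Finset (Sym2 V)) (i : V) :
    (nb M i).card = (M.filter (fun e => i ∈ e)).card := by
  have : (M.filter (fun e => i ∈ e)) = (nb M i).image fun j => s(i, j) := by
    ext e
    simp only [mem_filter, mem_image, mem_nb]
    constructor
    · rintro ⟨he, j, rfl⟩
      exact ⟨j, he, rfl⟩
    · rintro ⟨j, hj, rfl⟩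
      exact ⟨hj, by simp⟩
  rw [this, card_image_of_injective]
  intro a b h
  exact Sym2.congr_right.1 h

theorem sol_nonneg [DecidableEq V] {G : SimpleGraph V} {b : V → ℕ} {w : Sym2 V → ℝ}
    {M : Finset (Sym2 V)} {p : V → V → ℝ} (h : IsBSolution G b w M p) (i j : V) :
    0 ≤ p i j := by
  by_cases hM : s(i, j) ∈ M
  · exact (h.2.1 i j hM).1
  · exact (h.2.2 i j hM).ge

theorem utility_le [Fintype V] [DecidableEq V] {G : SimpleGraph V} {b : V → ℕ}
    {w : Sym2 V → ℝ} {M : Finset (Sym2 V)} {p : V → V → ℝ} (h : IsBSolution G b w M p)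
    (i j : V) (hM : s(i, j) ∈ M) : utility G b p i ≤ p i j := by
  refine Real.sSup_le ?_ (sol_nonneg h i j)
  intro t ht
  by_contra! hlt
  have h0 := sol_nonneg h i j
  have h1 : b i ≤ ((nb M i).erase j).card := by
    refine le_trans ht (card_le_card ?_)
    intro k hk
    simp only [mem_filter, mem_univ, true_and] at hk
    rw [mem_erase, mem_nb]
    refine ⟨?_, ?_⟩
    · rintro rfl; linarith [hk.2]
    · by_contra hn
      have := h.2.2 i k hn
      linarith [hk.2]
  have h2 := card_erase_lt_of_mem (mem_nb.2 hM)
  have h3 := h.1.2 i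
  rw [← card_nb] at h3
  omega

theorem utility_le_zero [Fintype V] [DecidableEq V] {G : SimpleGraph V} {b : V → ℕ}
    {w : Sym2 V → ℝ} {M : Finset (Sym2 V)} {p : V → V → ℝ} (h : IsBSolution G b w M p)
    (i : V) (hM : (nb M i).card < b i) : utility G b p i ≤ 0 := by
  refine Real.sSup_le ?_ le_rfl
  intro t ht
  by_contra! hlt
  have h1 : b i ≤ (nb M i).card := by
    refine le_trans ht (card_le_card ?_)
    intro k hk
    simp only [mem_filter, mem_univ, true_and] at hk
    rw [mem_nb]
    by_contra hn
    have := h.2.2 i k hn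
    linarith [hk.2]
  omega

theorem le_utility [Fintype V] {G : SimpleGraph V} {b : V → ℕ} (hb : ∀ i, 0 < b i)
    {p : V → V → ℝ} (i : V) (t : ℝ)
    (ht : b i ≤ (Finset.univ.filter (fun j : V => G.Adj i j ∧ t ≤ p i j)).card) :
    t ≤ utility G b p i := by
  refine le_csSup ⟨∑ j, |p i j|, ?_⟩ ht
  intro s hs
  have hpos : 0 < (Finset.univ.filter (fun j : V => G.Adj i j ∧ s ≤ p i j)).card :=
    lt_of_lt_of_le (hb i) hs
  obtain ⟨j, hj⟩ := Finset.card_pos.1 hpos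
  simp only [mem_filter, mem_univ, true_and] at hj
  have h1 : |p i j| ≤ ∑ j, |p i j| :=
    Finset.single_le_sum (f := fun j => |p i j|) (fun _ _ => abs_nonneg _) (mem_univ j)
  linarith [le_abs_self (p i j)]

theorem utility_nonneg [Fintype V] {G : SimpleGraph V} {b : V → ℕ} (hb : ∀ i, 0 < b i)
    {p : V → V → ℝ} (hp : ∀ i j, 0 ≤ p i j) (i : V) : 0 ≤ utility G b p i := by
  rcases Set.eq_empty_or_nonempty
    {t : ℝ | b i ≤ (Finset.univ.filter (fun j : V => G.Adj i j ∧ t ≤ p i j)).card} with h | h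
  · rw [utility, h, Real.sSup_empty]
  · obtain ⟨t, ht⟩ := h
    refine le_utility hb i 0 (le_trans ht (card_le_card ?_))
    intro k hk
    simp only [mem_filter, mem_univ, true_and] at hk ⊢
    exact ⟨hk.1, hp i k⟩

theorem sum_edges_le [Fintype V] [DecidableEq V] (G : SimpleGraph V) (w : Sym2 V → ℝ)
    (a : V → V → ℝ) (M : Finset (Sym2 V)) (hM : ∀ e ∈ M, e ∈ G.edgeSet)
    (h : ∀ i j, s(i, j) ∈ M → w s(i, j) ≤ a i j + a j i) :
    ∑ e ∈ M, w e ≤ ∑ i, ∑ j ∈ nb M i, a i j := by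
  induction M using Finset.induction_on with
  | empty => simp [nb]
  | insert e M he ih =>
    have ih' := ih (fun f hf => hM f (mem_insert_of_mem hf))
      (fun i j hij => h i j (mem_insert_of_mem hij))
    rw [sum_insert he]
    induction e with
    | h x y =>
      have hxy : x ≠ y := G.ne_of_adj (hM _ (mem_insert_self _ _))
      have h1 := h x y (mem_insert_self _ _)
      have h2 : ∑ i, ∑ j ∈ nb (insert s(x, y) M) i, a i j =
          ∑ i, ∑ j, ((if s(i, j) = s(x, y) then a i j else 0) +
            (if s(i, j) ∈ M then a i j else 0)) := by
        refine sum_congr rfl fun i _ => ?_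
        rw [nb, sum_filter]
        refine sum_congr rfl fun j _ => ?_
        by_cases h3 : s(i, j) = s(x, y)
        · have h4 : s(i, j) ∉ M := h3 ▸ he
          simp [h3, he]
        · simp [h3]
      have h3 : ∑ i, ∑ j, (if s(i, j) = s(x, y) then a i j else 0) = a x y + a y x := by
        rw [← Fintype.sum_prod_type']
        rw [← sum_filter]
        have : (univ.filter fun z : V × V => s(z.1, z.2) = s(x, y)) = {(x, y), (y, x)} := by
          ext ⟨i, j⟩
          simp
        rw [this, sum_pair (by simp [hxy])]
      have h4 : ∑ i, ∑ j, (if s(i, j) ∈ M then a i j else 0) = ∑ i, ∑ j ∈ nb M i, a i j := by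
        refine sum_congr rfl fun i _ => ?_
        rw [nb, sum_filter]
      rw [h2]
      simp only [sum_add_distrib]
      rw [h3, h4]
      linarith

theorem sol_weight [Fintype V] [DecidableEq V] (G : SimpleGraph V) (b : V → ℕ)
    (w : Sym2 V → ℝ) (M : Finset (Sym2 V)) (p : V → V → ℝ) (h : IsBSolution G b w M p) :
    mWeight w M = ∑ i, totalPayoff p i := by
  have h1 := sum_edges_le G w p M h.1.1 (fun i j hij => (h.2.1 i j hij).2.2.ge)
  have h2 := sum_edges_le G (fun e => -w e) (fun i j => -p i j) M h.1.1
    (fun i j hij => by linarith [(h.2.1 i j hij).2.2])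
  simp only [sum_neg_distrib, neg_le_neg_iff] at h2
  have h3 : ∀ i, ∑ j ∈ nb M i, p i j = totalPayoff p i := by
    intro i
    rw [totalPayoff]
    refine sum_subset (subset_univ _) fun j _ hj => ?_
    rw [mem_nb] at hj
    exact h.2.2 i j hj
  simp only [h3] at h1 h2
  exact le_antisymm h1 h2

theorem stable_bound [Fintype V] [DecidableEq V] (G : SimpleGraph V) (b : V → ℕ)
    (hb : ∀ i, 0 < b i) (w : Sym2 V → ℝ) (M : Finset (Sym2 V)) (p : V → V → ℝ)
    (h : IsBStable G b w M p) (S : Finset V) (M' : Finset (Sym2 V))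
    (hM' : IsBMatching G b M') (hS : EdgesIn S M') :
    mWeight w M' ≤ ∑ i ∈ S, totalPayoff p i := by
  obtain ⟨hs, hst⟩ := h
  have hp := sol_nonneg hs
  set u := utility G b p with hu
  have h1 := sum_edges_le G w (fun i j => if s(i, j) ∈ M then p i j else u i) M' hM'.1 (by
    intro i j hij
    have hji : s(j, i) = s(i, j) := Sym2.eq_swap
    simp only [hji]
    split_ifs with hm
    · exact (hs.2.1 i j hm).2.2.ge
    · exact hst i j (hM'.1 _ hij) hm)
  refine h1.trans ?_
  rw [← sum_subset (subset_univ S)]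
  · refine sum_le_sum fun i _ => ?_
    rw [← sum_inter_add_sum_sdiff (nb M' i) (nb M i)]
    have e1 : ∑ j ∈ nb M' i ∩ nb M i, (if s(i, j) ∈ M then p i j else u i) =
        ∑ j ∈ nb M i ∩ nb M' i, p i j := by
      rw [inter_comm]
      refine sum_congr rfl fun j hj => ?_
      rw [if_pos (mem_nb.1 (mem_inter.1 hj).1)]
    have e2 : ∑ j ∈ nb M' i \ nb M i, (if s(i, j) ∈ M then p i j else u i) =
        (nb M' i \ nb M i).card * u i := by
      rw [← nsmul_eq_mul, ← sum_const]
      refine sum_congr rfl fun j hj => ?_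
      rw [if_neg (fun hh => (mem_sdiff.1 hj).2 (mem_nb.2 hh))]
    have e3 : ∑ j ∈ nb M i, p i j ≤ totalPayoff p i :=
      sum_le_sum_of_subset_of_nonneg (subset_univ _) fun _ _ _ => hp _ _
    rw [← sum_inter_add_sum_sdiff (nb M i) (nb M' i)] at e3
    have hu0 : 0 ≤ u i := utility_nonneg hb hp i
    have e4 : (nb M' i \ nb M i).card * u i ≤ ∑ j ∈ nb M i \ nb M' i, p i j := by
      by_cases hc : (nb M i).card < b i
      · have : u i = 0 := le_antisymm (utility_le_zero hs i hc) hu0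
        rw [this, mul_zero]
        exact sum_nonneg fun _ _ => hp _ _
      · have c1 := hM'.2 i
        rw [← card_nb] at c1
        have c2 : (nb M' i \ nb M i).card ≤ (nb M i \ nb M' i).card := by
          have d1 := card_sdiff_add_card_inter (nb M' i) (nb M i)
          have d2 := card_sdiff_add_card_inter (nb M i) (nb M' i)
          rw [inter_comm] at d2
          omega
        have c3 : ∑ j ∈ nb M i \ nb M' i, u i ≤ ∑ j ∈ nb M i \ nb M' i, p i j :=
          sum_le_sum fun j hj => utility_le hs i j (mem_nb.1 (mem_sdiff.1 hj).1)
        rw [sum_const, nsmul_eq_mul] at c3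
        refine le_trans ?_ c3
        gcongr
    linarith
  · intro i _ hi
    have : nb M' i = ∅ := by
      rw [eq_empty_iff_forall_notMem]
      intro j hj
      exact hi (hS _ (mem_nb.1 hj) i (by simp))
    rw [this, sum_empty]

theorem stable_core [Fintype V] [DecidableEq V] (G : SimpleGraph V) (b : V → ℕ)
    (hb : ∀ i, 0 < b i) (w : Sym2 V → ℝ) (M : Finset (Sym2 V)) (p : V → V → ℝ)
    (h : IsBStable G b w M p) :
    mWeight w M = bVal G b w Finset.univ ∧ InCore (bVal G b w) (totalPayoff p) := by
  have hw := sol_weight G b w M p h.1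
  have hle : ∀ S : Finset V, bVal G b w S ≤ ∑ i ∈ S, totalPayoff p i := by
    intro S
    refine csSup_le ⟨_, ∅, ⟨by simp, by simp⟩, by simp [EdgesIn], rfl⟩ ?_
    rintro t ⟨M', h1, h2, rfl⟩
    exact stable_bound G b hb w M p h S M' h1 h2
  have hge : mWeight w M ≤ bVal G b w univ := by
    refine le_csSup ⟨∑ i, totalPayoff p i, ?_⟩ ⟨M, h.1.1, by simp [EdgesIn], rfl⟩
    rintro t ⟨M', h1, h2, rfl⟩
    exact stable_bound G b hb w M p h univ M' h1 h2
  have heq : mWeight w M = bVal G b w univ := le_antisymm hge (hw ▸ hle univ)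
  exact ⟨heq, hw ▸ heq, hle⟩

/-- residual arcs. -/
def resArc [Fintype V] [DecidableEq V] (G : SimpleGraph V) (b : V → ℕ) (A : Set V)
    (M : Finset (Sym2 V)) : Option V → Option V → Prop
  | some i, some j => G.Adj i j ∧ (i ∈ A ∧ s(i, j) ∉ M ∨ i ∉ A ∧ s(i, j) ∈ M)
  | some i, none => i ∈ A ∨ (nb M i).card < b i
  | none, some i => i ∉ A ∨ (nb M i).card < b i
  | none, none => False

/-- residual costs. -/
noncomputable def resCost (w : Sym2 V → ℝ) (A : Set V) : Option V → Option V → ℝ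
  | some i, some j => if i ∈ A then - w s(i, j) else w s(i, j)
  | _, _ => 0

theorem exists_max [Fintype V] [DecidableEq V] (G : SimpleGraph V) (b : V → ℕ)
    (w : Sym2 V → ℝ) : ∃ M, IsBMatching G b M ∧
      ∀ M', IsBMatching G b M' → mWeight w M' ≤ mWeight w M := by
  obtain ⟨M, hM, hmax⟩ := Finset.exists_max_image
    (univ.filter fun M : Finset (Sym2 V) => IsBMatching G b M) (mWeight w)
    ⟨∅, mem_filter.2 ⟨mem_univ _, by simp, by simp⟩⟩
  simp only [mem_filter, mem_univ, true_and] at hM hmax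
  exact ⟨M, hM, hmax⟩

theorem no_neg_cycle [Fintype V] [DecidableEq V] (G : SimpleGraph V) (b : V → ℕ)
    (w : Sym2 V → ℝ) (A : Set V) (hbip : ∀ i j : V, G.Adj i j → (i ∈ A ↔ j ∉ A))
    (M : Finset (Sym2 V)) (hM : IsBMatching G b M)
    (hmax : ∀ M', IsBMatching G b M' → mWeight w M' ≤ mWeight w M)
    (n : ℕ) (g : Fin (n + 1) → Option V) (hg : Function.Injective g)
    (hR : ∀ i, resArc G b A M (g i) (g (i + 1))) :
    0 ≤ ∑ i, resCost w A (g i) (g (i + 1)) := by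
  rcases isEmpty_or_nonempty V with hV | hV
  · refine sum_nonneg fun i _ => ?_
    cases hh : g i with
    | none => simp [resCost]
    | some x => exact (hV.false x).elim
  obtain ⟨d⟩ := hV
  let t : Fin (n + 1) → V := fun i => (g i).getD d
  let e : Fin (n + 1) → Sym2 V := fun i => s(t i, t (i + 1))
  let Ia : Finset (Fin (n + 1)) := univ.filter fun i =>
    g i = some (t i) ∧ g (i + 1) = some (t (i + 1)) ∧ t i ∈ A
  let Ir : Finset (Fin (n + 1)) := univ.filter fun i =>
    g i = some (t i) ∧ g (i + 1) = some (t (i + 1)) ∧ t i ∉ A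
  have mIa : ∀ i, i ∈ Ia ↔ g i = some (t i) ∧ g (i + 1) = some (t (i + 1)) ∧ t i ∈ A := by
    intro i; simp [Ia]
  have mIr : ∀ i, i ∈ Ir ↔ g i = some (t i) ∧ g (i + 1) = some (t (i + 1)) ∧ t i ∉ A := by
    intro i; simp [Ir]
  have ht : ∀ i x, g i = some x → t i = x := by
    intro i x h; simp [t, h]
  -- basic facts about the arcs of the two kinds
  have fa : ∀ i ∈ Ia, G.Adj (t i) (t (i + 1)) ∧ t (i + 1) ∉ A ∧ e i ∉ M := by
    intro i hi
    obtain ⟨h1, h2, h3⟩ := (mIa i).1 hi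
    have h4 := hR i
    rw [h1, h2] at h4
    obtain ⟨h5, h6⟩ := h4
    exact ⟨h5, (hbip _ _ h5).1 h3, by tauto⟩
  have fr : ∀ i ∈ Ir, G.Adj (t i) (t (i + 1)) ∧ t (i + 1) ∈ A ∧ e i ∈ M := by
    intro i hi
    obtain ⟨h1, h2, h3⟩ := (mIr i).1 hi
    have h4 := hR i
    rw [h1, h2] at h4
    obtain ⟨h5, h6⟩ := h4
    have := hbip _ _ h5
    refine ⟨h5, by tauto, by tauto⟩
  have inja : Set.InjOn e Ia := by
    intro i hi j hj hij
    have a1 := fa i hi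
    have a2 := fa j hj
    have b1 := (mIa i).1 hi
    have b2 := (mIa j).1 hj
    have : t i = t j := by
      rcases Sym2.eq_iff.1 hij with h | h
      · exact h.1
      · exact absurd (h.1 ▸ b1.2.2) a2.2.1
    exact hg (by rw [b1.1, b2.1, this])
  have injr : Set.InjOn e Ir := by
    intro i hi j hj hij
    have a1 := fr i hi
    have a2 := fr j hj
    have b1 := (mIr i).1 hi
    have b2 := (mIr j).1 hj
    have : t i = t j := by
      rcases Sym2.eq_iff.1 hij with h | h
      · exact h.1
      · exact absurd (h.1 ▸ a2.2.1) b1.2.2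
    exact hg (by rw [b1.1, b2.1, this])
  have hcost : ∑ i, resCost w A (g i) (g (i + 1)) =
      ∑ i ∈ Ir, w (e i) - ∑ i ∈ Ia, w (e i) := by
    rw [sum_filter, sum_filter, ← sum_sub_distrib]
    refine sum_congr rfl fun i _ => ?_
    cases h1 : g i with
    | none => simp [resCost]
    | some x =>
      cases h2 : g (i + 1) with
      | none => simp [resCost]
      | some y =>
        have h3 := ht i x h1
        have h4 := ht (i + 1) y h2
        simp only [e, h3, h4, resCost]
        by_cases h5 : x ∈ A <;> simp [h5]
  let M' := (M \ Ir.image e) ∪ Ia.image e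
  have hdisj : Disjoint (M \ Ir.image e) (Ia.image e) := by
    rw [disjoint_left]
    intro f hf hf'
    obtain ⟨i, hi, rfl⟩ := mem_image.1 hf'
    exact (fa i hi).2.2 (mem_sdiff.1 hf).1
  have hsub : Ir.image e ⊆ M := by
    intro f hf
    obtain ⟨i, hi, rfl⟩ := mem_image.1 hf
    exact (fr i hi).2.2
  have hweight : mWeight w M' = mWeight w M - ∑ i ∈ Ir, w (e i) + ∑ i ∈ Ia, w (e i) := by
    rw [mWeight, sum_union hdisj, sum_image inja, mWeight, ← sum_sdiff hsub, sum_image injr]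
    ring
  have hb' : IsBMatching G b M' := by
    refine ⟨?_, fun v => ?_⟩
    · intro f hf
      rcases mem_union.1 hf with h | h
      · exact hM.1 f (mem_sdiff.1 h).1
      · obtain ⟨i, hi, rfl⟩ := mem_image.1 h
        exact (fa i hi).1
    · have hMv := hM.2 v
      have hcard : (M'.filter (fun f => v ∈ f)).card ≤
          ((M \ Ir.image e).filter (fun f => v ∈ f)).card +
          ((Ia.image e).filter (fun f => v ∈ f)).card := by
        rw [filter_union]
        exact card_union_le _ _
      have hsd : ((M \ Ir.image e).filter (fun f => v ∈ f)).card ≤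
          (M.filter (fun f => v ∈ f)).card :=
        card_le_card (filter_subset_filter _ sdiff_subset)
      -- removal of at least one edge at `v`
      have hrem : ∀ i ∈ Ir, v ∈ e i → ((M \ Ir.image e).filter (fun f => v ∈ f)).card + 1 ≤
          (M.filter (fun f => v ∈ f)).card := by
        intro i hi hv
        refine card_lt_card ?_
        rw [ssubset_iff_of_subset (filter_subset_filter _ sdiff_subset)]
        refine ⟨e i, mem_filter.2 ⟨(fr i hi).2.2, hv⟩, fun hh => ?_⟩
        exact (mem_sdiff.1 (mem_filter.1 hh).1).2 (mem_image_of_mem e hi)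
      rcases ((Ia.image e).filter (fun f => v ∈ f)).eq_empty_or_nonempty with hemp | ⟨f, hf⟩
      · rw [hemp, card_empty] at hcard
        omega
      · obtain ⟨hf1, hvf⟩ := mem_filter.1 hf
        obtain ⟨i, hi, rfl⟩ := mem_image.1 hf1
        obtain ⟨g1, g2, g3⟩ := (mIa i).1 hi
        obtain ⟨k1, k2, k3⟩ := fa i hi
        have hone : ((Ia.image e).filter (fun f => v ∈ f)).card ≤ 1 := by
          rw [card_le_one]
          intro f1 hf1 f2 hf2
          obtain ⟨p1, q1⟩ := mem_filter.1 hf1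
          obtain ⟨p2, q2⟩ := mem_filter.1 hf2
          obtain ⟨j1, hj1, rfl⟩ := mem_image.1 p1
          obtain ⟨j2, hj2, rfl⟩ := mem_image.1 p2
          have x1 := (mIa j1).1 hj1
          have x2 := (mIa j2).1 hj2
          have y1 := fa j1 hj1
          have y2 := fa j2 hj2
          have : j1 = j2 := by
            rcases Sym2.mem_iff.1 q1 with r1 | r1 <;> rcases Sym2.mem_iff.1 q2 with r2 | r2
            · exact hg (by rw [x1.1, x2.1, ← r1, ← r2])
            · exact absurd (r1 ▸ x1.2.2) (r2 ▸ y2.2.1)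
            · exact absurd (r2 ▸ x2.2.2) (r1 ▸ y1.2.1)
            · exact add_right_cancel (hg (by rw [x1.2.1, x2.2.1, ← r1, ← r2]))
          rw [this]
        suffices hsuff : (nb M v).card < b v ∨
            ((M \ Ir.image e).filter (fun f => v ∈ f)).card + 1 ≤
              (M.filter (fun f => v ∈ f)).card by
          rw [card_nb] at hsuff
          omega
        rcases Sym2.mem_iff.1 hvf with hv | hv
        · -- `v` is the tail: look at the previous arc
          have hprev := hR (i - 1)
          rw [sub_add_cancel, g1] at hprev
          cases hh : g (i - 1) with
          | none =>
            rw [hh] at hprev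
            rcases hprev with h | h
            · exact absurd g3 h
            · exact Or.inl (hv ▸ h)
          | some x =>
            rw [hh] at hprev
            have hx := ht _ _ hh
            have hxA : x ∉ A := fun hxA => (hbip _ _ hprev.1).1 hxA g3
            refine Or.inr (hrem (i - 1) ((mIr _).2 ⟨by rw [hh, hx], ?_, by rwa [hx]⟩) ?_)
            · rw [sub_add_cancel]; exact g1
            · simp [e, hv]
        · -- `v` is the head: look at the next arc
          have hnext := hR (i + 1)
          rw [g2] at hnext
          cases hh : g (i + 1 + 1) with
          | none =>
            rw [hh] at hnext
            rcases hnext with h | h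
            · exact absurd h k2
            · exact Or.inl (hv ▸ h)
          | some x =>
            rw [hh] at hnext
            have hx := ht _ _ hh
            refine Or.inr (hrem (i + 1) ((mIr _).2 ⟨g2, by rw [hh, hx], k2⟩) ?_)
            simp [e, hv]
  have := hmax M' hb'
  rw [hweight] at this
  rw [hcost]
  linarith

theorem exists_stable [Fintype V] [DecidableEq V] (G : SimpleGraph V) (b : V → ℕ)
    (hb : ∀ i, 0 < b i) (w : Sym2 V → ℝ) (hw : ∀ e ∈ G.edgeSet, 0 < w e)
    (A : Set V) (hbip : ∀ i j : V, G.Adj i j → (i ∈ A ↔ j ∉ A)) :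
    ∃ (M : Finset (Sym2 V)) (p : V → V → ℝ), IsBStable G b w M p := by
  obtain ⟨M, hM, hmax⟩ := exists_max G b w
  obtain ⟨q, hq⟩ := exists_potential (resArc G b A M) (resCost w A)
    (no_neg_cycle G b w A hbip M hM hmax)
  let y : V → ℝ := fun i => if i ∈ A then q (some i) - q none else q none - q (some i)
  have y0 : ∀ i, 0 ≤ y i := by
    intro i
    by_cases hi : i ∈ A
    · have := hq (some i) none (Or.inl hi)
      simp only [resCost] at this
      simp only [y, if_pos hi]; linarith
    · have := hq none (some i) (Or.inl hi)
      simp only [resCost] at this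
      simp only [y, if_neg hi]; linarith
  have y1 : ∀ i, (nb M i).card < b i → y i = 0 := by
    intro i hi
    refine le_antisymm ?_ (y0 i)
    by_cases hA : i ∈ A
    · have := hq none (some i) (Or.inr hi)
      simp only [resCost] at this
      simp only [y, if_pos hA]; linarith
    · have := hq (some i) none (Or.inr hi)
      simp only [resCost] at this
      simp only [y, if_neg hA]; linarith
  have y2 : ∀ i j, i ∈ A → G.Adj i j → s(i, j) ∉ M → w s(i, j) ≤ y i + y j := by
    intro i j hi hij hm
    have hj : j ∉ A := (hbip i j hij).1 hi
    have := hq (some i) (some j) ⟨hij, Or.inl ⟨hi, hm⟩⟩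
    simp only [resCost, if_pos hi] at this
    simp only [y, if_pos hi, if_neg hj]; linarith
  have y3 : ∀ i j, i ∉ A → G.Adj i j → s(i, j) ∈ M → y i + y j ≤ w s(i, j) := by
    intro i j hi hij hm
    have hj : j ∈ A := by have := hbip i j hij; tauto
    have := hq (some i) (some j) ⟨hij, Or.inr ⟨hi, hm⟩⟩
    simp only [resCost, if_neg hi] at this
    simp only [y, if_neg hi, if_pos hj]; linarith
  have y2' : ∀ i j, G.Adj i j → s(i, j) ∉ M → w s(i, j) ≤ y i + y j := by
    intro i j hij hm
    by_cases hi : i ∈ A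
    · exact y2 i j hi hij hm
    · have hj : j ∈ A := by have := hbip i j hij; tauto
      have := y2 j i hj hij.symm (by rwa [Sym2.eq_swap])
      rw [Sym2.eq_swap, add_comm]; exact this
  have y3' : ∀ i j, s(i, j) ∈ M → y i + y j ≤ w s(i, j) := by
    intro i j hm
    have hij : G.Adj i j := hM.1 _ hm
    by_cases hi : i ∈ A
    · have hj : j ∉ A := (hbip i j hij).1 hi
      have := y3 j i hj hij.symm (by rwa [Sym2.eq_swap])
      rw [Sym2.eq_swap, add_comm]; exact this
    · exact y3 i j hi hij hm
  let p : V → V → ℝ := fun i j =>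
    if s(i, j) ∈ M then y i + (w s(i, j) - y i - y j) / 2 else 0
  have py : ∀ i j, s(i, j) ∈ M → y i ≤ p i j := by
    intro i j hm
    simp only [p, if_pos hm]
    linarith [y3' i j hm]
  have hsol : IsBSolution G b w M p := by
    refine ⟨hM, ?_, ?_⟩
    · intro i j hm
      have hm' : s(j, i) ∈ M := by rwa [Sym2.eq_swap]
      refine ⟨(y0 i).trans (py i j hm), (y0 j).trans (py j i hm'), ?_⟩
      have hji : s(j, i) = s(i, j) := Sym2.eq_swap
      simp only [p, hji, if_pos hm]
      ring
    · intro i j hm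
      simp only [p, if_neg hm]
  have yu : ∀ i, y i ≤ utility G b p i := by
    intro i
    by_cases hc : (nb M i).card < b i
    · rw [y1 i hc]
      exact utility_nonneg hb (sol_nonneg hsol) i
    · refine le_utility hb i (y i) ((not_lt.1 hc).trans (card_le_card ?_))
      intro j hj
      rw [mem_nb] at hj
      simp only [mem_filter, mem_univ, true_and]
      exact ⟨hM.1 _ hj, py i j hj⟩
  exact ⟨M, p, hsol, fun i j hij hm => (y2' i j hij hm).trans (add_le_add (yu i) (yu j))⟩

/-- every bipartite instance `(G,b,w)` of Multiple Partners Assignment has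
a stable solution; moreover, for every stable solution `(M,p)`, `M` is a maximum weight
`b`-matching of `G` and `p^t` is a core allocation of the `b`-assignment game on
`(G,b,w)`. -/
theorem statement7 [Fintype V] [DecidableEq V] (G : SimpleGraph V) (b : V → ℕ)
    (hb : ∀ i, 0 < b i) (w : Sym2 V → ℝ) (hw : ∀ e ∈ G.edgeSet, 0 < w e)
    (A : Set V) (hbip : ∀ i j : V, G.Adj i j → (i ∈ A ↔ j ∉ A)) :
    (∃ (M : Finset (Sym2 V)) (p : V → V → ℝ), IsBStable G b w M p) ∧
      ∀ (M : Finset (Sym2 V)) (p : V → V → ℝ), IsBStable G b w M p →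
        mWeight w M = bVal G b w Finset.univ ∧
          InCore (bVal G b w) (totalPayoff p) := by
  exact ⟨exists_stable G b hb w hw A hbip, fun M p h => stable_core G b hb w M p h⟩

end MatchingGames
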